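/- arXiv:math/0612272 — 4 statements merged into one kernel-verified Lean document; each statement's English description precedes it below -/
import Mathlib

section
/- Let d ≥ 1 and let μ be a probability measure on the countable group A(ℚ) of d×d upper triangular matrices with rational entries and nonzero diagonal entries. Assume the moment condition: ∫_{A(ℚ)} Σ_{i≤j, a_{i,j}≠0} ( Σ_{p prime} |ln |a_{i,j}|_p| + |ln |a_{i,j}|_∞| ) dμ(a) < ∞. Then μ has finite entropy, i.e. H(μ) := − Σ_{a ∈ A(ℚ)} μ({a}) ln μ({a}) < ∞. -/
noncomputable section
open MeasureTheory

/-- The group `A(ℚ)` of `d × d` upper triangular matrices with rational entries and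
nonzero diagonal entries. -/
def TriQ (d : ℕ) : Type :=
  {a : Matrix (Fin d) (Fin d) ℚ // (∀ i j : Fin d, j < i → a i j = 0) ∧ ∀ i, a i i ≠ 0}

instance (d : ℕ) : MeasurableSpace (TriQ d) := ⊤

/-- For a nonzero rational `q`, `Σ_p |ln |q|_p| + |ln |q|_∞|`, the sum being over all primes. -/
def ratGauge (q : ℚ) : ℝ :=
  (∑' p : Nat.Primes, |Real.log ((padicNorm (p : ℕ) q : ℚ) : ℝ)|) + |Real.log (|(q : ℝ)|)|

lemma padic_term (q : ℚ) (hq : q ≠ 0) (p : ℕ) (hp : p.Prime) :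
    |Real.log ((padicNorm p q : ℚ) : ℝ)|
      = ((q.num.natAbs * q.den).factorization p : ℝ) * Real.log p := by
  haveI : Fact p.Prime := ⟨hp⟩
  have hn : q.num.natAbs ≠ 0 := by simpa using hq
  have hd : q.den ≠ 0 := q.den_nz
  have hlog : 0 ≤ Real.log p := Real.log_natCast_nonneg p
  rw [padicNorm.eq_zpow_of_nonzero hq]
  push_cast
  rw [Real.log_zpow, abs_mul, abs_of_nonneg hlog, Nat.factorization_mul hn hd]
  congr 1
  have hv : padicValRat p q = (q.num.natAbs.factorization p : ℤ) - (q.den.factorization p : ℤ) := by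
    rw [padicValRat, padicValInt, Nat.factorization_def _ hp, Nat.factorization_def _ hp]
  rw [hv]
  simp only [Finsupp.add_apply]
  have hc : q.num.natAbs.Coprime q.den := q.reduced
  by_cases h1 : p ∣ q.num.natAbs
  · have h2 : ¬ p ∣ q.den := fun h2 => by
      have := Nat.dvd_gcd h1 h2
      rw [hc] at this
      exact hp.one_lt.ne' (Nat.dvd_one.mp this)
    rw [Nat.factorization_eq_zero_of_not_dvd h2]
    simp
  · rw [Nat.factorization_eq_zero_of_not_dvd h1]
    simp

lemma log_le_ratGauge (q : ℚ) (hq : q ≠ 0) :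
    Real.log ((q.num.natAbs * q.den : ℕ) : ℝ) ≤ ratGauge q := by
  have h : (∑' p : Nat.Primes, |Real.log ((padicNorm (p : ℕ) q : ℚ) : ℝ)|)
      = Real.log ((q.num.natAbs * q.den : ℕ) : ℝ) := by
    set N := q.num.natAbs * q.den with hN
    have h1 : (∑' p : Nat.Primes, |Real.log ((padicNorm (p : ℕ) q : ℚ) : ℝ)|)
        = ∑' p : {p : ℕ | p.Prime}, (fun p : ℕ => (N.factorization p : ℝ) * Real.log p) p := by
      exact tsum_congr fun p => padic_term q hq p p.2
    rw [h1, tsum_subtype {p : ℕ | p.Prime} (fun p : ℕ => (N.factorization p : ℝ) * Real.log p), Real.log_nat_eq_sum_factorization, Finsupp.sum,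
      tsum_eq_sum (s := N.factorization.support)]
    · refine Finset.sum_congr rfl fun p hp => ?_
      rw [Set.indicator_of_mem]
      exact Nat.prime_of_mem_primeFactors (by simpa using hp)
    · intro p hp
      have : N.factorization p = 0 := by simpa only [Finsupp.mem_support_iff, not_not] using hp
      simp [Set.indicator_apply, this]
  rw [ratGauge, h]
  exact le_add_of_nonneg_right (abs_nonneg _)

/-- The gauge with value zero at zero. -/
def gg (q : ℚ) : ℝ := if q ≠ 0 then ratGauge q else 0

lemma gg_nonneg (q : ℚ) : 0 ≤ gg q := by
  unfold gg
  split_ifs with h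
  · exact (Real.log_natCast_nonneg _).trans (log_le_ratGauge q h)
  · exact le_rfl

lemma exp_gg_le (q : ℚ) (hq : q ≠ 0) :
    Real.exp (-(2 * gg q)) ≤ (1 / (q.num : ℝ) ^ 2) * (1 / (q.den : ℝ) ^ 2) := by
  have h := log_le_ratGauge q hq
  have hn : q.num.natAbs ≠ 0 := by simpa using hq
  have hN : (0 : ℝ) < ((q.num.natAbs * q.den : ℕ) : ℝ) := by
    exact_mod_cast Nat.pos_of_ne_zero (mul_ne_zero hn q.den_nz)
  have hg : gg q = ratGauge q := if_pos hq
  have h2 : Real.exp (-(2 * gg q)) ≤ Real.exp (-(2 * Real.log ((q.num.natAbs * q.den : ℕ) : ℝ))) := by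
    rw [hg]; gcongr
  refine h2.trans (le_of_eq ?_)
  rw [Real.exp_neg, two_mul, Real.exp_add, Real.exp_log hN]
  push_cast
  rw [Nat.cast_natAbs]
  push_cast
  rw [← sq_abs (q.num : ℝ)]
  field_simp

lemma summable_gg : Summable fun q : ℚ => Real.exp (-(2 * gg q)) := by
  have h1 : Summable fun n : ℤ => 1 / (n : ℝ) ^ 2 := Real.summable_one_div_int_pow.mpr one_lt_two
  have h2 : Summable fun n : ℕ => 1 / (n : ℝ) ^ 2 := Real.summable_one_div_nat_pow.mpr one_lt_two
  have h3 := h1.mul_of_nonneg h2 (fun n => by positivity) (fun n => by positivity)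
  have hinj : Function.Injective fun q : ℚ => (q.num, q.den) := by
    intro a b hab
    simp only [Prod.mk.injEq] at hab
    exact Rat.ext hab.1 hab.2
  have h4 := h3.comp_injective hinj
  have h5 : Summable fun q : ℚ => if q = 0 then (1 : ℝ) else 0 :=
    summable_of_ne_finset_zero (s := {0}) (fun q hq => by simpa using hq)
  refine Summable.of_nonneg_of_le (fun q => (Real.exp_pos _).le) (fun q => ?_) (h4.add h5)
  by_cases hq : q = 0
  · subst hq
    simp [gg]
  · simpa [hq] using exp_gg_le q hq

lemma tsum_pi_lt_top {ι α : Type*} [Fintype ι] [DecidableEq ι] [DecidableEq α] (w : α → ENNReal)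
    (hw : ∑' x, w x ≠ ⊤) : ∑' f : ι → α, ∏ i, w (f i) ≠ ⊤ := by
  refine ne_top_of_le_ne_top (ENNReal.pow_ne_top hw : (∑' x, w x) ^ Fintype.card ι ≠ ⊤) ?_
  rw [ENNReal.tsum_eq_iSup_sum]
  refine iSup_le fun s => ?_
  have hs : s ⊆ Fintype.piFinset fun i => s.image fun f => f i := by
    intro f hf
    rw [Fintype.mem_piFinset]
    exact fun i => Finset.mem_image_of_mem _ hf
  calc ∑ f ∈ s, ∏ i, w (f i)
      ≤ ∑ f ∈ Fintype.piFinset fun i => s.image fun f => f i, ∏ i, w (f i) :=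
        Finset.sum_le_sum_of_subset hs
    _ = ∏ i, ∑ x ∈ s.image (fun f => f i), w x := (Finset.prod_univ_sum _ _).symm
    _ ≤ ∏ _i : ι, ∑' x, w x := Finset.prod_le_prod' fun i _ => ENNReal.sum_le_tsum _
    _ = _ := by simp

lemma entropy_term (x c : ℝ) (hx : 0 ≤ x) :
    -(x * Real.log x) ≤ c * x + Real.exp (-c) := by
  rcases hx.eq_or_lt with rfl | hx
  · simpa using (Real.exp_pos _).le
  · have h := Real.log_le_sub_one_of_pos (div_pos (Real.exp_pos (-c)) hx)
    rw [Real.log_div (Real.exp_pos _).ne' hx.ne', Real.log_exp] at h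
    have h2 := mul_le_mul_of_nonneg_left h hx.le
    have h3 : x * (Real.exp (-c) / x - 1) = Real.exp (-c) - x := by field_simp
    rw [h3] at h2
    nlinarith

/-- if `μ` is a probability measure on `A(ℚ)` with
`∫ Σ_{i ≤ j, a_{i,j} ≠ 0} (Σ_p |ln |a_{i,j}|_p| + |ln |a_{i,j}|_∞|) dμ(a) < ∞`,
then `μ` has finite entropy `H(μ) = − Σ_a μ({a}) ln μ({a}) < ∞`. -/
theorem finite_entropy (d : ℕ) (hd : 1 ≤ d) (μ : Measure (TriQ d)) [IsProbabilityMeasure μ]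
    (hmom : ∫⁻ a, ENNReal.ofReal
        (∑ i, ∑ j, if i ≤ j ∧ a.1 i j ≠ 0 then ratGauge (a.1 i j) else 0) ∂μ < ⊤) :
    ∑' a : TriQ d, ENNReal.ofReal (-((μ {a}).toReal * Real.log (μ {a}).toReal)) < ⊤ := by
  set G : TriQ d → ℝ := fun a =>
    ∑ i, ∑ j, if i ≤ j ∧ a.1 i j ≠ 0 then ratGauge (a.1 i j) else 0 with hG
  have hG2 : ∀ a, G a = ∑ i, ∑ j, gg (a.1 i j) := by
    intro a
    refine Finset.sum_congr rfl fun i _ => Finset.sum_congr rfl fun j _ => ?_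
    unfold gg
    by_cases hij : i ≤ j
    · simp [hij]
    · simp [hij, a.2.1 i j (not_le.mp hij)]
  have hG0 : ∀ a, 0 ≤ G a := fun a => by
    rw [hG2]
    exact Finset.sum_nonneg fun i _ => Finset.sum_nonneg fun j _ => gg_nonneg _
  haveI : Countable (TriQ d) := by
    have : Countable (Matrix (Fin d) (Fin d) ℚ) :=
      inferInstanceAs (Countable (Fin d → Fin d → ℚ))
    exact Subtype.countable
  haveI : MeasurableSingletonClass (TriQ d) := ⟨fun _ => trivial⟩
  rw [lintegral_countable'] at hmom
  have hsum : ∑' a : TriQ d, ENNReal.ofReal (Real.exp (-(2 * G a))) ≠ ⊤ := by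
    have h1 : ∑' q : ℚ, ENNReal.ofReal (Real.exp (-(2 * gg q))) ≠ ⊤ :=
      summable_gg.tsum_ofReal_ne_top
    have h2 := tsum_pi_lt_top (ι := Fin d × Fin d) _ h1
    let e : TriQ d → (Fin d × Fin d → ℚ) := fun a x => a.1 x.1 x.2
    have he : Function.Injective e := by
      intro a b hab
      apply Subtype.ext
      ext i j
      exact congrFun hab (i, j)
    have h3 := ENNReal.tsum_comp_le_tsum_of_injective he
      (fun f : Fin d × Fin d → ℚ => ∏ i, ENNReal.ofReal (Real.exp (-(2 * gg (f i)))))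
    refine ne_top_of_le_ne_top h2 (le_trans (le_of_eq ?_) h3)
    refine tsum_congr fun a => ?_
    rw [← ENNReal.ofReal_prod_of_nonneg (fun i _ => (Real.exp_pos _).le), ← Real.exp_sum, hG2]
    congr 2
    rw [Fintype.sum_prod_type]
    simp only [Finset.mul_sum, Finset.sum_neg_distrib, e]
  calc ∑' a : TriQ d, ENNReal.ofReal (-((μ {a}).toReal * Real.log (μ {a}).toReal))
      ≤ ∑' a : TriQ d, (2 * (ENNReal.ofReal (G a) * μ {a})
          + ENNReal.ofReal (Real.exp (-(2 * G a)))) := by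
        refine ENNReal.tsum_le_tsum fun a => ?_
        refine (ENNReal.ofReal_le_ofReal
          (entropy_term (μ {a}).toReal (2 * G a) ENNReal.toReal_nonneg)).trans ?_
        refine ENNReal.ofReal_add_le.trans (le_of_eq ?_)
        rw [ENNReal.ofReal_mul (mul_nonneg zero_le_two (hG0 a)), ENNReal.ofReal_mul zero_le_two,
          ENNReal.ofReal_toReal (measure_ne_top _ _), mul_assoc]
        simp
    _ < ⊤ := by
        rw [ENNReal.tsum_add, ENNReal.tsum_mul_left]
        exact ENNReal.add_lt_top.mpr
          ⟨ENNReal.mul_lt_top (by simp) hmom, lt_top_iff_ne_top.mpr hsum⟩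
end
end

section
/- Let F be ℚ_p for some prime p, or F = ℝ, with absolute value |·|. Let m ≥ 2 and let (g_n)_{n≥1} be a sequence of m×m upper triangular matrices over F with nonzero diagonal entries and (g_n)_{m,m} = 1 for all n. Set x_n = g_1⋯g_n and c_n = max_{i,j} |(g_{n+1})_{i,j}|. Assume: (a) for every k < m, (1/n) Σ_{l=1}^n ln |(g_l)_{k,k}| converges to a limit φ(k) < 0; (b) (1/n) ln c_n → 0. Then: (i) for all k ≤ k' < m there exists α > 0 such that |(x_n)_{k,k'}| ≤ e^{−αn} for all sufficiently large n; (ii) for every k < m, the sequence ((x_n)_{k,m})_{n≥1} converges in F. -/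
noncomputable section
open Filter Topology


/-- Exponential decay with a global constant. -/
def ExpDecay (y : ℕ → ℝ) : Prop :=
  ∃ α : ℝ, 0 < α ∧ ∃ C : ℝ, 0 < C ∧ ∀ n : ℕ, y n ≤ C * Real.exp (-(α * n))

lemma global_of_eventually {f h : ℕ → ℝ} (hh : ∀ n, 0 < h n) (hev : ∀ᶠ n in atTop, f n ≤ h n) :
    ∃ C : ℝ, 0 < C ∧ ∀ n, f n ≤ C * h n := by
  obtain ⟨N, hN⟩ := eventually_atTop.1 hev
  refine ⟨1 + ∑ i ∈ Finset.range N, |f i| / h i, ?_, ?_⟩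
  · have : 0 ≤ ∑ i ∈ Finset.range N, |f i| / h i :=
      Finset.sum_nonneg fun i _ => div_nonneg (abs_nonneg _) (hh i).le
    linarith
  · intro n
    have h0 : ∀ i ∈ Finset.range N, 0 ≤ |f i| / h i :=
      fun i _ => div_nonneg (abs_nonneg _) (hh i).le
    have hS : 0 ≤ ∑ i ∈ Finset.range N, |f i| / h i := Finset.sum_nonneg h0
    by_cases hn : N ≤ n
    · have := hN n hn
      nlinarith [mul_nonneg hS (hh n).le]
    · have h1 : |f n| / h n ≤ ∑ i ∈ Finset.range N, |f i| / h i :=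
        Finset.single_le_sum h0 (Finset.mem_range.2 (not_le.1 hn))
      rw [div_le_iff₀ (hh n)] at h1
      have := le_abs_self (f n)
      nlinarith [hh n]

lemma ExpDecay.mono {y z : ℕ → ℝ} (h : ExpDecay z) (hyz : ∀ n, y n ≤ z n) : ExpDecay y := by
  obtain ⟨α, hα, C, hC, h⟩ := h
  exact ⟨α, hα, C, hC, fun n => (hyz n).trans (h n)⟩

lemma ExpDecay.zero : ExpDecay (fun _ => 0) :=
  ⟨1, one_pos, 1, one_pos, fun n => by positivity⟩

lemma ExpDecay.add {y z : ℕ → ℝ} (hy : ExpDecay y) (hz : ExpDecay z) :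
    ExpDecay (fun n => y n + z n) := by
  obtain ⟨α, hα, C, hC, h⟩ := hy
  obtain ⟨β, hβ, D, hD, h'⟩ := hz
  refine ⟨min α β, lt_min hα hβ, C + D, by positivity, fun n => ?_⟩
  have hn : (0 : ℝ) ≤ n := Nat.cast_nonneg n
  have h1 : Real.exp (-(α * n)) ≤ Real.exp (-(min α β * n)) := by
    gcongr
    exact min_le_left _ _
  have h2 : Real.exp (-(β * n)) ≤ Real.exp (-(min α β * n)) := by
    gcongr
    exact min_le_right _ _
  have := h n
  have := h' n
  nlinarith

lemma ExpDecay.sum {ι : Type*} (s : Finset ι) (y : ι → ℕ → ℝ) (h : ∀ i ∈ s, ExpDecay (y i)) :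
    ExpDecay (fun n => ∑ i ∈ s, y i n) := by
  classical
  induction s using Finset.induction_on with
  | empty => simpa using ExpDecay.zero
  | insert a s ha ih =>
    simp only [Finset.sum_insert ha]
    exact (h a (by simp)).add (ih fun i hi => h i (by simp [hi]))

/-- Product with a subexponential sequence. -/
lemma ExpDecay.mul_subexp {y c : ℕ → ℝ} (hy : ExpDecay y) (hc0 : ∀ n, 0 < c n)
    (hc : Tendsto (fun n : ℕ => Real.log (c n) / n) atTop (𝓝 0)) :
    ExpDecay (fun n => y n * c n) := by
  obtain ⟨α, hα, C, hC, h⟩ := hy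
  have hev : ∀ᶠ n : ℕ in atTop, c n ≤ Real.exp (α / 2 * n) := by
    filter_upwards [hc.eventually (gt_mem_nhds (half_pos hα)), eventually_gt_atTop 0] with n h1 h2
    have hn : (0 : ℝ) < n := by exact_mod_cast h2
    rw [div_lt_iff₀ hn] at h1
    rw [← Real.log_le_iff_le_exp (hc0 n)]
    exact h1.le
  obtain ⟨K, hK, hK'⟩ := global_of_eventually (fun n => Real.exp_pos _) hev
  refine ⟨α / 2, half_pos hα, C * K, by positivity, fun n => ?_⟩
  calc y n * c n ≤ (C * Real.exp (-(α * n))) * (K * Real.exp (α / 2 * n)) := by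
        exact mul_le_mul (h n) (hK' n) (hc0 n).le (by positivity)
    _ = C * K * (Real.exp (-(α * n)) * Real.exp (α / 2 * n)) := by ring
    _ = C * K * Real.exp (-(α / 2 * n)) := by
        rw [← Real.exp_add]; congr 2; ring

lemma ExpDecay.eventually {y : ℕ → ℝ} (hy : ExpDecay y) :
    ∃ α : ℝ, 0 < α ∧ ∀ᶠ n : ℕ in atTop, y n ≤ Real.exp (-(α * n)) := by
  obtain ⟨α, hα, C, hC, h⟩ := hy
  refine ⟨α / 2, half_pos hα, ?_⟩
  have ht : Tendsto (fun n : ℕ => Real.exp (α / 2 * n)) atTop atTop :=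
    Real.tendsto_exp_atTop.comp
      (tendsto_natCast_atTop_atTop.const_mul_atTop (half_pos hα))
  filter_upwards [ht.eventually (eventually_ge_atTop C)] with n hn
  calc y n ≤ C * Real.exp (-(α * n)) := h n
    _ ≤ Real.exp (α / 2 * n) * Real.exp (-(α * n)) := by gcongr
    _ = Real.exp (-(α / 2 * n)) := by rw [← Real.exp_add]; congr 1; ring

/-- The scalar recursion. -/
lemma ExpDecay.recursion {y a b : ℕ → ℝ} {φ : ℝ} (hφ : φ < 0) (ha : ∀ n, 0 < a n)
    (hlim : Tendsto (fun n : ℕ => (∑ l ∈ Finset.range n, Real.log (a l)) / n) atTop (𝓝 φ))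
    (hb : ExpDecay b) (hrec : ∀ n, y (n + 1) ≤ y n * a n + b n) : ExpDecay y := by
  obtain ⟨β₀, hβ₀, B, hB, hb⟩ := hb
  obtain ⟨β, hβ, hββ₀, hβφ⟩ : ∃ β : ℝ, 0 < β ∧ β ≤ β₀ ∧ β ≤ -φ :=
    ⟨min β₀ (-φ), lt_min hβ₀ (by linarith), min_le_left _ _, min_le_right _ _⟩
  have hb : ∀ n : ℕ, b n ≤ B * Real.exp (-(β * n)) := fun n => (hb n).trans (by gcongr)
  set A : ℕ → ℝ := fun n => ∏ l ∈ Finset.range n, a l with hA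
  have hApos : ∀ n, 0 < A n := fun n => Finset.prod_pos fun l _ => ha l
  have hAsucc : ∀ n, A (n + 1) = A n * a n := fun n => Finset.prod_range_succ _ _
  have hlog : ∀ n, Real.log (A n) = ∑ l ∈ Finset.range n, Real.log (a l) :=
    fun n => Real.log_prod fun l _ => (ha l).ne'
  have hup : ∀ᶠ n : ℕ in atTop, A n ≤ Real.exp ((φ + β / 8) * n) := by
    filter_upwards [hlim.eventually (gt_mem_nhds (show φ < φ + β / 8 by linarith)),
      eventually_gt_atTop 0] with n h1 h2
    have hn : (0 : ℝ) < n := by exact_mod_cast h2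
    rw [div_lt_iff₀ hn, ← hlog] at h1
    rw [← Real.log_le_iff_le_exp (hApos n)]
    exact h1.le
  have hlow : ∀ᶠ n : ℕ in atTop, (A n)⁻¹ ≤ Real.exp ((-φ + β / 8) * n) := by
    filter_upwards [hlim.eventually (lt_mem_nhds (show φ - β / 8 < φ by linarith)),
      eventually_gt_atTop 0] with n h1 h2
    have hn : (0 : ℝ) < n := by exact_mod_cast h2
    rw [lt_div_iff₀ hn, ← hlog] at h1
    rw [← Real.log_le_iff_le_exp (inv_pos.2 (hApos n)), Real.log_inv]
    linarith
  obtain ⟨U, hU, hup⟩ := global_of_eventually (fun n => Real.exp_pos _) hup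
  obtain ⟨V, hV, hlow⟩ := global_of_eventually (fun n => Real.exp_pos _) hlow
  set γ : ℝ := -φ + β / 8 - β with hγ
  clear_value A
  set W : ℝ := B * V * Real.exp (-φ + β / 8) with hW
  have hWpos : 0 < W := by positivity
  have hbA : ∀ n : ℕ, b n * (A (n + 1))⁻¹ ≤ W * Real.exp (γ * n) := by
    intro n
    calc b n * (A (n + 1))⁻¹
        ≤ (B * Real.exp (-(β * n))) * (V * Real.exp ((-φ + β / 8) * (n + 1 : ℕ))) :=
          mul_le_mul (hb n) (hlow (n + 1)) (inv_pos.2 (hApos _)).le (by positivity)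
      _ = B * V * (Real.exp (-(β * n)) * Real.exp ((-φ + β / 8) * (n + 1 : ℕ))) := by ring
      _ = B * V * (Real.exp (-φ + β / 8) * Real.exp (γ * n)) := by
          rw [← Real.exp_add, ← Real.exp_add]; congr 2; push_cast; rw [hγ]; ring
      _ = W * Real.exp (γ * n) := by rw [hW]; ring
  obtain ⟨δ, hδ0, hδγ, hδ⟩ : ∃ δ : ℝ, 0 ≤ δ ∧ γ ≤ δ ∧ φ + β / 8 + δ ≤ -(β / 2) :=
    ⟨max γ 0, le_max_right _ _, le_max_left _ _, by
      rcases max_cases γ 0 with ⟨h, _⟩ | ⟨h, _⟩ <;> rw [h] <;> linarith⟩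
  set K : ℝ := |y 0 * (A 0)⁻¹| + W with hK
  have hKpos : 0 < K := by positivity
  have hWK : W ≤ K := by rw [hK]; linarith [abs_nonneg (y 0 * (A 0)⁻¹)]
  have hz : ∀ n : ℕ, y n * (A n)⁻¹ ≤ K * (n + 1) * Real.exp (δ * n) := by
    intro n
    induction n with
    | zero =>
      have := le_abs_self (y 0 * (A 0)⁻¹)
      simp only [Nat.cast_zero, mul_zero, Real.exp_zero]
      rw [hK]; linarith
    | succ n ih =>
      have e1 : Real.exp (γ * n) ≤ Real.exp (δ * n) := by gcongr
      have e2 : Real.exp (δ * n) ≤ Real.exp (δ * (n + 1 : ℕ)) := by gcongr; simp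
      have hstep : y (n + 1) * (A (n + 1))⁻¹ ≤ y n * (A n)⁻¹ + b n * (A (n + 1))⁻¹ := by
        have h1 : y (n + 1) * (A (n + 1))⁻¹ ≤ (y n * a n + b n) * (A (n + 1))⁻¹ :=
          mul_le_mul_of_nonneg_right (hrec n) (inv_pos.2 (hApos _)).le
        have h2 : y n * a n * (A (n + 1))⁻¹ = y n * (A n)⁻¹ := by
          rw [hAsucc]; have := (ha n).ne'; have := (hApos n).ne'; field_simp
        rw [add_mul, h2] at h1
        exact h1
      calc y (n + 1) * (A (n + 1))⁻¹ ≤ y n * (A n)⁻¹ + b n * (A (n + 1))⁻¹ := hstep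
        _ ≤ K * (n + 1) * Real.exp (δ * n) + W * Real.exp (γ * n) := add_le_add ih (hbA n)
        _ ≤ K * (n + 1) * Real.exp (δ * n) + K * Real.exp (δ * n) := by gcongr
        _ = K * (n + 1 + 1) * Real.exp (δ * n) := by ring
        _ ≤ K * (n + 1 + 1) * Real.exp (δ * (n + 1 : ℕ)) := by gcongr
        _ = _ := by push_cast; ring
  refine ⟨β / 4, by positivity, K * U * (1 + 4 / β), by positivity, fun n => ?_⟩
  have hn1 : (n : ℝ) + 1 ≤ (1 + 4 / β) * Real.exp (β / 4 * n) := by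
    have h1 := Real.add_one_le_exp (β / 4 * n)
    have h2 : 1 ≤ Real.exp (β / 4 * n) := Real.one_le_exp (by positivity)
    have h3 : (n : ℝ) ≤ 4 / β * Real.exp (β / 4 * n) := by
      calc (n : ℝ) = 4 / β * (β / 4 * n) := by field_simp
        _ ≤ _ := by gcongr; linarith
    linarith
  calc y n = y n * (A n)⁻¹ * A n := by have := (hApos n).ne'; field_simp
    _ ≤ (K * (n + 1) * Real.exp (δ * n)) * (U * Real.exp ((φ + β / 8) * n)) :=
        mul_le_mul (hz n) (hup n) (hApos n).le (by positivity)
    _ = K * U * (n + 1) * Real.exp ((φ + β / 8 + δ) * n) := by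
        rw [show (φ + β / 8 + δ) * n = δ * n + (φ + β / 8) * n by ring, Real.exp_add]; ring
    _ ≤ K * U * ((1 + 4 / β) * Real.exp (β / 4 * n)) * Real.exp (-(β / 2) * n) := by gcongr
    _ = K * U * (1 + 4 / β) * (Real.exp (β / 4 * n) * Real.exp (-(β / 2) * n)) := by ring
    _ = _ := by rw [← Real.exp_add]; congr 2; ring

/-- `F = ℚ_p` (`p` prime) or `F = ℝ`; `(g_n)_{n≥1}` (here `g_{n+1} := g n`) is a
sequence of `m × m` (`m = m₀ + 2 ≥ 2`) upper triangular matrices over `F` with nonzero diagonal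
entries and `(g_n)_{m,m} = 1`; `x_n = g_1 ⋯ g_n`; `c_n = max_{i,j} |(g_{n+1})_{i,j}|`.
Assuming (a) `(1/n) Σ_{l=1}^n ln |(g_l)_{k,k}| → φ(k) < 0` for each `k < m` and
(b) `(1/n) ln c_n → 0`, then (i) for all `k ≤ k' < m` there is `α > 0` with
`|(x_n)_{k,k'}| ≤ e^{−αn}` for `n` large, and (ii) for each `k < m`, `(x_n)_{k,m}` converges. -/
theorem triangular_contraction (m₀ : ℕ) (F : Type) [NormedField F] [CompleteSpace F]
    (hF : (∃ (p : ℕ) (hp : p.Prime), ∃ e : F ≃+* (@Padic p ⟨hp⟩), ∀ x : F, ‖e x‖ = ‖x‖) ∨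
      (∃ e : F ≃+* ℝ, ∀ x : F, ‖e x‖ = ‖x‖))
    (g : ℕ → Matrix (Fin (m₀ + 2)) (Fin (m₀ + 2)) F)
    (htri : ∀ n, ∀ i j : Fin (m₀ + 2), j < i → g n i j = 0)
    (hdiag : ∀ n, ∀ i : Fin (m₀ + 2), g n i i ≠ 0)
    (hlast : ∀ n, g n (Fin.last (m₀ + 1)) (Fin.last (m₀ + 1)) = 1)
    (φ : Fin (m₀ + 2) → ℝ)
    (hφneg : ∀ k : Fin (m₀ + 2), k ≠ Fin.last (m₀ + 1) → φ k < 0)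
    (hconv : ∀ k : Fin (m₀ + 2), k ≠ Fin.last (m₀ + 1) →
      Tendsto (fun n : ℕ => (∑ l ∈ Finset.range n, Real.log ‖g l k k‖) / n) atTop (𝓝 (φ k)))
    (hc : Tendsto (fun n : ℕ =>
        Real.log (⨆ i : Fin (m₀ + 2), ⨆ j : Fin (m₀ + 2), ‖g n i j‖) / n) atTop (𝓝 0)) :
    (∀ k k' : Fin (m₀ + 2), k ≤ k' → k' ≠ Fin.last (m₀ + 1) →
      ∃ α : ℝ, 0 < α ∧ ∀ᶠ n : ℕ in atTop,
        ‖(((List.range n).map g).prod) k k'‖ ≤ Real.exp (-(α * n))) ∧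
    (∀ k : Fin (m₀ + 2), k ≠ Fin.last (m₀ + 1) →
      ∃ L : F, Tendsto (fun n : ℕ => (((List.range n).map g).prod) k (Fin.last (m₀ + 1)))
        atTop (𝓝 L)) := by
  classical
  set x : ℕ → Matrix (Fin (m₀ + 2)) (Fin (m₀ + 2)) F := fun n => ((List.range n).map g).prod with hx
  set c : ℕ → ℝ := fun n => ⨆ i : Fin (m₀ + 2), ⨆ j : Fin (m₀ + 2), ‖g n i j‖ with hcdef
  have hgc : ∀ n i j, ‖g n i j‖ ≤ c n := fun n i j =>
    (le_ciSup (f := fun j => ‖g n i j‖) (Set.finite_range _).bddAbove j).trans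
      (le_ciSup (f := fun i => ⨆ j, ‖g n i j‖) (Set.finite_range _).bddAbove i)
  have hcpos : ∀ n, 0 < c n := fun n => (norm_pos_iff.2 (hdiag n 0)).trans_le (hgc n 0 0)
  have hrec : ∀ n k k', x (n + 1) k k' =
      x n k k' * g n k' k' + ∑ j ∈ Finset.univ.erase k', x n k j * g n j k' := by
    intro n k k'
    have : x (n + 1) = x n * g n := by
      simp [hx, List.range_succ]
    rw [this, Matrix.mul_apply]
    exact (Finset.add_sum_erase Finset.univ (fun j => x n k j * g n j k')
      (Finset.mem_univ k')).symm
  have hforce : ∀ k k', (∀ j, j < k' → ExpDecay (fun n => ‖x n k j‖)) →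
      ExpDecay (fun n => ‖∑ j ∈ Finset.univ.erase k', x n k j * g n j k'‖) := by
    intro k k' h
    refine ExpDecay.mono (ExpDecay.sum (Finset.univ.erase k')
      (fun j n => ‖x n k j * g n j k'‖) fun j hj => ?_) (fun n => norm_sum_le _ _)
    rcases lt_or_gt_of_ne (Finset.ne_of_mem_erase hj) with hlt | hgt
    · refine ((h j hlt).mul_subexp hcpos hc).mono fun n => ?_
      rw [norm_mul]
      exact mul_le_mul_of_nonneg_left (hgc n j k') (norm_nonneg _)
    · refine ExpDecay.zero.mono fun n => ?_
      rw [htri n j k' hgt]; simp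
  have hdecay : ∀ k k' : Fin (m₀ + 2), k' ≠ Fin.last (m₀ + 1) →
      ExpDecay (fun n => ‖x n k k'‖) := by
    intro k k'
    induction k' using WellFoundedLT.induction with
    | ind k' ih =>
      intro hk'
      refine ExpDecay.recursion (hφneg k' hk') (fun n => norm_pos_iff.2 (hdiag n k'))
        (hconv k' hk') (hforce k k' fun j hj => ih j hj (hj.trans_le (Fin.le_last k')).ne) ?_
      intro n
      rw [hrec]
      exact (norm_add_le _ _).trans (by rw [norm_mul])
  refine ⟨fun k k' _ hk' => (hdecay k k' hk').eventually, fun k _ => ?_⟩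
  obtain ⟨α, hα, C, hC, hd⟩ := hforce k (Fin.last (m₀ + 1)) fun j hj => hdecay k j hj.ne
  refine cauchySeq_tendsto_of_complete
    (cauchySeq_of_le_geometric (Real.exp (-α)) C (by simpa using hα) fun n => ?_)
  rw [dist_comm, dist_eq_norm]
  have h1 := hd n
  have h2 := hrec n k (Fin.last (m₀ + 1))
  rw [hlast, mul_one] at h2
  simp only [hx] at h2 h1 ⊢
  rw [h2, add_sub_cancel_left, ← Real.exp_nat_mul]
  refine h1.trans (le_of_eq ?_)
  congr 2; ring
end
end

section
/- Let d ≥ 1. For a ∈ A(ℚ), write a = uδ with δ = diag(a_{1,1},…,a_{d,d}) and u unipotent upper triangular (so u_{i,j} = a_{i,j}/a_{j,j} for i < j), and define the length ‖a‖ := Σ_{i<j} Σ_{p ∈ 𝒫∪{∞}} ln⁺|u_{i,j}|_p + Σ_{i=1}^d Σ_{p ∈ 𝒫} |ln |a_{i,i}|_p|. Then for every real k ≥ 0, the number of a ∈ A(ℚ) with ‖a‖ ≤ k is at most (2 e^{6k})^{d²}. -/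
noncomputable section

/-- `⟨q⟩⁺ = Σ_{p ∈ 𝒫∪{∞}} ln⁺|q|_p` for a rational `q`; `ln⁺ x = max (ln x) 0`, and the
convention `ln⁺|0|_p = 0` holds automatically since `Real.log 0 = 0`. -/
def ratGaugePlus (q : ℚ) : ℝ :=
  (∑' p : Nat.Primes, max (Real.log ((padicNorm (p : ℕ) q : ℚ) : ℝ)) 0) +
    max (Real.log (|(q : ℝ)|)) 0

/-- The adelic length `‖a‖ = Σ_{i<j} ⟨a_{i,j}/a_{j,j}⟩⁺ + Σ_i Σ_{p ∈ 𝒫} |ln |a_{i,i}|_p|` of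
`a = uδ ∈ A(ℚ)` with `u` unipotent (`u_{i,j} = a_{i,j}/a_{j,j}`) and `δ` its diagonal. -/
def lengthA (d : ℕ) (a : TriQ d) : ℝ :=
  (∑ i, ∑ j, if i < j then ratGaugePlus (a.1 i j / a.1 j j) else 0) +
    ∑ i, ∑' p : Nat.Primes, |Real.log ((padicNorm (p : ℕ) (a.1 i i) : ℚ) : ℝ)|

theorem hasSum_log_nat (n : ℕ) (hn : n ≠ 0) :
    HasSum (fun p : Nat.Primes => (padicValNat (p : ℕ) n : ℝ) * Real.log (p : ℕ))
      (Real.log n) := by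
  have h : HasSum (fun p : ℕ => (n.factorization p : ℝ) * Real.log p) (Real.log n) := by
    rw [Real.log_nat_eq_sum_factorization, Finsupp.sum]
    apply hasSum_sum_of_ne_finset_zero
    intro b hb
    have : n.factorization b = 0 := Finsupp.notMem_support_iff.1 hb
    simp [this]
  have h2 := (hasSum_subtype_iff_of_support_subset (s := {p : ℕ | p.Prime}) (by
    intro p hp
    by_contra hc
    apply hp
    have : n.factorization p = 0 := Nat.factorization_eq_zero_of_not_prime n hc
    simp [this])).2 h
  have h3 : (fun p : Nat.Primes => (padicValNat (p : ℕ) n : ℝ) * Real.log (p : ℕ)) =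
      fun p : Nat.Primes => (n.factorization (p : ℕ) : ℝ) * Real.log (p : ℕ) := by
    funext p
    rw [Nat.factorization_def n p.2]
  rw [h3]
  exact h2

theorem log_padicNorm (p : Nat.Primes) (q : ℚ) (hq : q ≠ 0) :
    Real.log ((padicNorm (p : ℕ) q : ℚ) : ℝ) =
      ((padicValNat (p : ℕ) q.den : ℝ) - padicValNat (p : ℕ) q.num.natAbs) *
        Real.log (p : ℕ) := by
  rw [padicNorm.eq_zpow_of_nonzero hq]
  push_cast
  rw [Real.log_zpow, padicValRat, padicValInt, Int.cast_neg, Int.cast_sub, Int.cast_natCast,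
    Int.cast_natCast]
  ring

theorem padicVal_or (p : Nat.Primes) (q : ℚ) :
    padicValNat (p : ℕ) q.den = 0 ∨ padicValNat (p : ℕ) q.num.natAbs = 0 := by
  by_contra! h
  have h1 : (p : ℕ) ∣ q.den := dvd_of_one_le_padicValNat (Nat.one_le_iff_ne_zero.2 h.1)
  have h2 : (p : ℕ) ∣ q.num.natAbs := dvd_of_one_le_padicValNat (Nat.one_le_iff_ne_zero.2 h.2)
  exact Nat.not_coprime_of_dvd_of_dvd p.2.one_lt h2 h1 q.reduced

theorem log_prime_nonneg (p : Nat.Primes) : 0 ≤ Real.log (p : ℕ) :=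
  Real.log_natCast_nonneg _

theorem tsum_plus (q : ℚ) :
    (∑' p : Nat.Primes, max (Real.log ((padicNorm (p : ℕ) q : ℚ) : ℝ)) 0) = Real.log q.den := by
  by_cases hq : q = 0
  · subst hq; simp
  rw [← (hasSum_log_nat q.den q.den_nz).tsum_eq]
  congr 1
  funext p
  rw [log_padicNorm p q hq]
  have hp := log_prime_nonneg p
  rcases padicVal_or p q with h | h
  · rw [h, max_eq_right]
    · simp
    · have : (0 : ℝ) ≤ padicValNat (p : ℕ) q.num.natAbs := Nat.cast_nonneg _
      push_cast
      nlinarith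
  · rw [h, max_eq_left]
    · simp
    · simp only [Nat.cast_zero, sub_zero]; positivity

theorem tsum_abs (q : ℚ) (hq : q ≠ 0) :
    (∑' p : Nat.Primes, |Real.log ((padicNorm (p : ℕ) q : ℚ) : ℝ)|) =
      Real.log q.den + Real.log q.num.natAbs := by
  rw [← ((hasSum_log_nat q.den q.den_nz).add
    (hasSum_log_nat q.num.natAbs (by simpa using hq))).tsum_eq]
  congr 1
  funext p
  rw [log_padicNorm p q hq, abs_mul, abs_of_nonneg (log_prime_nonneg p), ← add_mul]
  congr 1
  rcases padicVal_or p q with h | h <;> rw [h] <;> simp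

theorem ratGauge_nonneg (q : ℚ) : 0 ≤ ratGaugePlus q := by
  rw [ratGaugePlus, tsum_plus]
  have := Real.log_natCast_nonneg q.den
  positivity

theorem le_floor_of_log {n : ℕ} {k : ℝ} (h : Real.log n ≤ k) : n ≤ ⌊Real.exp k⌋₊ := by
  rcases Nat.eq_zero_or_pos n with h0 | h0
  · simp [h0]
  · apply Nat.le_floor
    rwa [← Real.log_le_iff_le_exp (by exact_mod_cast h0)]

theorem gauge_bound {q : ℚ} {k : ℝ} (h : ratGaugePlus q ≤ k) :
    q.num.natAbs ≤ ⌊Real.exp k⌋₊ ∧ q.den ≤ ⌊Real.exp k⌋₊ := by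
  rw [ratGaugePlus, tsum_plus] at h
  have h1 := le_max_left (Real.log (|(q : ℝ)|)) 0
  have h2 := le_max_right (Real.log (|(q : ℝ)|)) 0
  refine ⟨?_, le_floor_of_log (by linarith)⟩
  by_cases hq : q = 0
  · simp [hq]
  apply le_floor_of_log
  have hd : (q.den : ℝ) ≠ 0 := by exact_mod_cast q.den_nz
  have : (q.num.natAbs : ℝ) = |(q : ℝ)| * q.den := by
    rw [Nat.cast_natAbs, Int.cast_abs, Rat.cast_def q, abs_div, Nat.abs_cast]
    field_simp
  rw [this, Real.log_mul (by simpa using hq) hd]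
  linarith

theorem abs_bound {q : ℚ} (hq : q ≠ 0) {k : ℝ}
    (h : (∑' p : Nat.Primes, |Real.log ((padicNorm (p : ℕ) q : ℚ) : ℝ)|) ≤ k) :
    q.num.natAbs ≤ ⌊Real.exp k⌋₊ ∧ q.den ≤ ⌊Real.exp k⌋₊ := by
  rw [tsum_abs q hq] at h
  have h1 := Real.log_natCast_nonneg q.den
  have h2 := Real.log_natCast_nonneg q.num.natAbs
  exact ⟨le_floor_of_log (by linarith), le_floor_of_log (by linarith)⟩

/-- Rationals of height at most `N`. -/
def upSet (N : ℕ) : Finset ℚ :=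
  (Finset.Icc (-(N : ℤ)) N ×ˢ Finset.Icc 1 N).image fun x => (x.1 : ℚ) / (x.2 : ℚ)

/-- Nonzero rationals of height at most `N`. -/
def diagSet (N : ℕ) : Finset ℚ :=
  ((Finset.Icc (-(N : ℤ)) N).erase 0 ×ˢ Finset.Icc 1 N).image fun x => (x.1 : ℚ) / (x.2 : ℚ)

theorem card_upSet (N : ℕ) : (upSet N).card ≤ (2 * N + 1) * N := by
  refine Finset.card_image_le.trans ?_
  rw [Finset.card_product, Int.card_Icc, Nat.card_Icc]
  apply Nat.mul_le_mul <;> omega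

theorem card_diagSet (N : ℕ) : (diagSet N).card ≤ 2 * N * N := by
  refine Finset.card_image_le.trans ?_
  rw [Finset.card_product, Finset.card_erase_of_mem (by simp), Int.card_Icc, Nat.card_Icc]
  apply Nat.mul_le_mul <;> omega

theorem mem_upSet {q : ℚ} {N : ℕ} (h : q.num.natAbs ≤ N ∧ q.den ≤ N) : q ∈ upSet N := by
  rw [upSet, Finset.mem_image]
  refine ⟨(q.num, q.den), ?_, Rat.num_div_den q⟩
  have := q.den_pos
  simp only [Finset.mem_product, Finset.mem_Icc]
  omega

theorem mem_diagSet {q : ℚ} (hq : q ≠ 0) {N : ℕ} (h : q.num.natAbs ≤ N ∧ q.den ≤ N) :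
    q ∈ diagSet N := by
  rw [diagSet, Finset.mem_image]
  refine ⟨(q.num, q.den), ?_, Rat.num_div_den q⟩
  have := q.den_pos
  have h0 : q.num ≠ 0 := by simpa using hq
  simp only [Finset.mem_product, Finset.mem_Icc, Finset.mem_erase]
  omega

/-- Coordinates `(u, δ)` of a triangular matrix. -/
def coord (d : ℕ) (a : TriQ d) : Fin d → Fin d → ℚ :=
  fun i j => if i < j then a.1 i j / a.1 j j else a.1 i j

theorem coord_injective (d : ℕ) : Function.Injective (coord d) := by
  intro a b h
  have key : ∀ i j, coord d a i j = coord d b i j := fun i j => by rw [h]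
  have hdg : ∀ j, a.1 j j = b.1 j j := fun j => by simpa [coord] using key j j
  apply Subtype.ext
  ext i j
  have := key i j
  unfold coord at this
  split_ifs at this with hij
  · rw [hdg j] at this
    exact (div_left_inj' (b.2.2 j)).1 this
  · exact this

/-- The range of each coordinate. -/
def boxSet (d N : ℕ) (i j : Fin d) : Finset ℚ :=
  if i < j then upSet N else if j < i then {0} else diagSet N

theorem coord_mem (d : ℕ) (k : ℝ) (a : TriQ d) (h : lengthA d a ≤ k) :
    coord d a ∈ Fintype.piFinset fun i => Fintype.piFinset fun j =>
      boxSet d ⌊Real.exp k⌋₊ i j := by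
  simp only [Fintype.mem_piFinset]
  intro i j
  unfold lengthA at h
  have n1 : ∀ i j : Fin d, 0 ≤ (if i < j then ratGaugePlus (a.1 i j / a.1 j j) else 0) := by
    intro i j
    split_ifs
    · exact ratGauge_nonneg _
    · exact le_rfl
  have n1' : ∀ i : Fin d, 0 ≤ ∑ j, (if i < j then ratGaugePlus (a.1 i j / a.1 j j) else 0) :=
    fun i => Finset.sum_nonneg fun j _ => n1 i j
  have n2 : ∀ i : Fin d, 0 ≤ ∑' p : Nat.Primes,
      |Real.log ((padicNorm (p : ℕ) (a.1 i i) : ℚ) : ℝ)| :=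
    fun i => tsum_nonneg fun p => abs_nonneg _
  have N1 := Finset.sum_nonneg fun i (_ : i ∈ Finset.univ) => n1' i
  have N2 := Finset.sum_nonneg fun i (_ : i ∈ Finset.univ) => n2 i
  unfold coord boxSet
  rcases lt_trichotomy i j with hij | hij | hij
  · rw [if_pos hij, if_pos hij]
    apply mem_upSet
    apply gauge_bound
    have s1 := Finset.single_le_sum (fun j _ => n1 i j) (Finset.mem_univ j)
    have s2 := Finset.single_le_sum (fun i _ => n1' i) (Finset.mem_univ i)
    rw [if_pos hij] at s1
    linarith
  · subst hij
    simp only [lt_irrefl, if_false]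
    apply mem_diagSet (a.2.2 i)
    apply abs_bound (a.2.2 i)
    have s2 := Finset.single_le_sum (fun i _ => n2 i) (Finset.mem_univ i)
    linarith
  · rw [if_neg hij.asymm, if_neg hij.asymm, if_pos hij, a.2.1 i j hij]
    simp

theorem box_pair (d N : ℕ) (hN : 1 ≤ N) (i j : Fin d) :
    (boxSet d N i j).card * (boxSet d N j i).card ≤ (2 * N ^ 6) ^ 2 := by
  have e1 : N ^ 2 ≤ N ^ 12 := Nat.pow_le_pow_right hN (by norm_num)
  have e2 : N ^ 4 ≤ N ^ 12 := Nat.pow_le_pow_right hN (by norm_num)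
  have hu := card_upSet N
  have hd := card_diagSet N
  have hu' : (2 * N + 1) * N ≤ 4 * N ^ 2 := by nlinarith
  have e3 : (2 * N ^ 6) ^ 2 = 4 * N ^ 12 := by ring
  rw [e3]
  unfold boxSet
  rcases lt_trichotomy i j with hij | hij | hij
  · simp only [hij, hij.asymm, if_true, if_false, Finset.card_singleton]
    omega
  · subst hij
    simp only [lt_irrefl, if_false]
    calc _ ≤ (2 * N * N) * (2 * N * N) := Nat.mul_le_mul hd hd
      _ = 4 * N ^ 4 := by ring
      _ ≤ _ := by omega
  · simp only [hij, hij.asymm, if_true, if_false, Finset.card_singleton]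
    omega

theorem box_card (d N : ℕ) (hN : 1 ≤ N) :
    (Fintype.piFinset fun i => Fintype.piFinset fun j => boxSet d N i j).card ≤
      (2 * N ^ 6) ^ (d ^ 2) := by
  simp only [Fintype.card_piFinset]
  refine (Nat.pow_le_pow_iff_left (n := 2) (by norm_num)).1 ?_
  calc (∏ i, ∏ j, (boxSet d N i j).card) ^ 2
      = (∏ i, ∏ j, (boxSet d N i j).card) * ∏ i, ∏ j, (boxSet d N j i).card := by
        rw [sq]; congr 1; exact Finset.prod_comm
    _ = ∏ i, ∏ j, ((boxSet d N i j).card * (boxSet d N j i).card) := by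
        simp only [Finset.prod_mul_distrib]
    _ ≤ ∏ _i : Fin d, ∏ _j : Fin d, (2 * N ^ 6) ^ 2 :=
        Finset.prod_le_prod' fun i _ => Finset.prod_le_prod' fun j _ => box_pair d N hN i j
    _ = ((2 * N ^ 6) ^ (d ^ 2)) ^ 2 := by
        simp only [Finset.prod_const, Finset.card_univ, Fintype.card_fin]
        rw [← pow_mul, ← pow_mul, ← pow_mul]
        congr 1
        ring

/-- for every `k ≥ 0`, the set of `a ∈ A(ℚ)` with `‖a‖ ≤ k` is finite, of
cardinality at most `(2 e^{6k})^{d²}`. -/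
theorem card_lengthA_le (d : ℕ) (hd : 1 ≤ d) (k : ℝ) (hk : 0 ≤ k) :
    {a : TriQ d | lengthA d a ≤ k}.Finite ∧
    (Nat.card {a : TriQ d | lengthA d a ≤ k} : ℝ) ≤ (2 * Real.exp (6 * k)) ^ (d ^ 2) := by
  set N := ⌊Real.exp k⌋₊ with hN
  have hN1 : 1 ≤ N := Nat.le_floor (by simpa using hk)
  set B := Fintype.piFinset fun i => Fintype.piFinset fun j => boxSet d N i j with hB
  have hmaps : Set.MapsTo (coord d) {a : TriQ d | lengthA d a ≤ k} (B : Set _) :=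
    fun a ha => coord_mem d k a ha
  have hinj : Set.InjOn (coord d) {a : TriQ d | lengthA d a ≤ k} :=
    (coord_injective d).injOn
  refine ⟨Set.Finite.of_injOn hmaps hinj B.finite_toSet, ?_⟩
  have hc : Nat.card {a : TriQ d | lengthA d a ≤ k} ≤ B.card := by
    rw [Nat.card_coe_set_eq, ← Set.ncard_coe_finset]
    exact Set.ncard_le_ncard_of_injOn (coord d) hmaps hinj B.finite_toSet
  have hc2 := hc.trans (box_card d N hN1)
  have hNe : (N : ℝ) ≤ Real.exp k := Nat.floor_le (Real.exp_pos k).le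
  calc (Nat.card {a : TriQ d | lengthA d a ≤ k} : ℝ)
      ≤ (2 * (N : ℝ) ^ 6) ^ (d ^ 2) := by exact_mod_cast hc2
    _ ≤ (2 * Real.exp k ^ 6) ^ (d ^ 2) := by gcongr
    _ = (2 * Real.exp (6 * k)) ^ (d ^ 2) := by
        rw [← Real.exp_nat_mul]; norm_num
end
end

section
/- Let x = ((x_p)_{p prime}, x_∞) be an adele of ℚ, i.e. x_p ∈ ℚ_p for every prime p with |x_p|_p ≤ 1 for all but finitely many p, and x_∞ ∈ ℝ. Then there exists a rational number q such that |x_p − q|_p ≤ 1 for every prime p and |x_∞ − q| ≤ 1. -/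
theorem adele_local (p : ℕ) [hp : Fact p.Prime] (y : ℚ_[p]) :
    ∃ q : ℚ, ‖y - (q : ℚ_[p])‖ ≤ 1 ∧
      ∀ (l : ℕ) [hl : Fact l.Prime], l ≠ p → ‖(q : ℚ_[l])‖ ≤ 1 := by
  have hp1 : (1 : ℝ) < p := by exact_mod_cast hp.out.one_lt
  have hp0 : (p : ℚ_[p]) ≠ 0 := by exact_mod_cast hp.out.ne_zero
  obtain ⟨n, hn⟩ := pow_unbounded_of_one_lt ‖y‖ hp1
  have hpn : (0 : ℝ) < (p : ℝ) ^ n := by positivity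
  have hz : ‖y * (p : ℚ_[p]) ^ n‖ ≤ 1 := by
    rw [norm_mul, norm_pow, Padic.norm_p, inv_pow, ← div_eq_mul_inv, div_le_one hpn]
    exact hn.le
  let z : ℤ_[p] := ⟨y * (p : ℚ_[p]) ^ n, hz⟩
  have ha := PadicInt.appr_spec n z
  rw [← PadicInt.norm_le_pow_iff_mem_span_pow] at ha
  refine ⟨(z.appr n : ℚ) / (p : ℚ) ^ n, ?_, ?_⟩
  · have h1 : ‖y * (p : ℚ_[p]) ^ n - (z.appr n : ℚ_[p])‖ ≤ (p : ℝ) ^ (-(n : ℤ)) := by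
      have := ha
      rw [PadicInt.norm_def, PadicInt.coe_sub, PadicInt.coe_natCast] at this
      exact this
    have h2 : y - (((z.appr n : ℚ) / (p : ℚ) ^ n : ℚ) : ℚ_[p])
        = (y * (p : ℚ_[p]) ^ n - (z.appr n : ℚ_[p])) / (p : ℚ_[p]) ^ n := by
      push_cast
      field_simp
    rw [h2, norm_div, norm_pow, Padic.norm_p, inv_pow, div_inv_eq_mul]
    calc _ ≤ (p : ℝ) ^ (-(n : ℤ)) * (p : ℝ) ^ n := by gcongr
      _ = 1 := by
        rw [zpow_neg, zpow_natCast]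
        exact inv_mul_cancel₀ hpn.ne'
  · intro l hl hlp
    have h1 : ‖(p : ℚ_[l])‖ = 1 := by
      rw [Padic.norm_natCast_eq_one_iff]
      exact (Nat.coprime_primes hl.out hp.out).2 hlp
    push_cast
    rw [norm_div, norm_pow, h1, one_pow, div_one]
    exact_mod_cast Padic.norm_int_le_one (p := l) (z.appr n : ℤ)

theorem adele_norm_add (p : ℕ) [hp : Fact p.Prime] {a b : ℚ_[p]} (ha : ‖a‖ ≤ 1) (hb : ‖b‖ ≤ 1) :
    ‖a + b‖ ≤ 1 := (Padic.nonarchimedean a b).trans (max_le ha hb)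

theorem adele_norm_sub (p : ℕ) [hp : Fact p.Prime] {a b : ℚ_[p]} (ha : ‖a‖ ≤ 1) (hb : ‖b‖ ≤ 1) :
    ‖a - b‖ ≤ 1 := by
  rw [sub_eq_add_neg]
  exact adele_norm_add p ha (by rwa [norm_neg])

theorem adele_finite (x : ∀ (p : ℕ) [hp : Fact p.Prime], ℚ_[p]) (S : Finset ℕ) :
    ∃ q : ℚ, ∀ (p : ℕ) [hp : Fact p.Prime],
      (p ∈ S → ‖x p - (q : ℚ_[p])‖ ≤ 1) ∧ (p ∉ S → ‖(q : ℚ_[p])‖ ≤ 1) := by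
  induction S using Finset.induction_on with
  | empty => exact ⟨0, fun p hp => by simp⟩
  | insert a S haS ih =>
    obtain ⟨q, hq⟩ := ih
    by_cases hpa : a.Prime
    · haveI : Fact a.Prime := ⟨hpa⟩
      obtain ⟨c, hc, hc'⟩ := adele_local a (x a)
      refine ⟨q + c, fun p hp => ?_⟩
      by_cases h : p = a
      · subst h
        refine ⟨fun _ => ?_, fun h => absurd (Finset.mem_insert_self _ _) h⟩
        have := adele_norm_sub p hc ((hq p).2 haS)
        push_cast
        convert this using 2
        ring
      · rw [Finset.mem_insert, or_iff_right h]
        have hcp := hc' p h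
        push_cast
        refine ⟨fun hm => ?_, fun hm => adele_norm_add p ((hq p).2 hm) hcp⟩
        have := adele_norm_sub p ((hq p).1 hm) hcp
        rwa [sub_sub] at this
    · refine ⟨q, fun p hp => ?_⟩
      have h : p ≠ a := fun h => hpa (h ▸ hp.out)
      rw [Finset.mem_insert, or_iff_right h]
      exact hq p

/-- given an adele of `ℚ`, i.e. a family `x_p ∈ ℚ_p` (over all primes `p`) with
`|x_p|_p ≤ 1` for all but finitely many `p`, together with `x_∞ ∈ ℝ`, there is a rational `q`
with `|x_p − q|_p ≤ 1` for every prime `p` and `|x_∞ − q| ≤ 1`. -/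
theorem adele_approximation
    (x : ∀ (p : ℕ) [hp : Fact p.Prime], ℚ_[p]) (xr : ℝ)
    (hfin : {p : ℕ | ∃ hp : p.Prime, 1 < ‖@x p ⟨hp⟩‖}.Finite) :
    ∃ q : ℚ, (∀ (p : ℕ) (hp : p.Prime), ‖@x p ⟨hp⟩ - ((q : ℚ) : @Padic p ⟨hp⟩)‖ ≤ 1) ∧
      |xr - (q : ℝ)| ≤ 1 := by
  obtain ⟨q, hq⟩ := adele_finite x hfin.toFinset
  refine ⟨q + (⌊xr - q⌋ : ℤ), fun p hp => ?_, ?_⟩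
  · haveI : Fact p.Prime := ⟨hp⟩
    have h1 : ‖x p - (q : ℚ_[p])‖ ≤ 1 := by
      by_cases hm : p ∈ hfin.toFinset
      · exact (hq p).1 hm
      · have hx : ‖x p‖ ≤ 1 := by
          by_contra h
          exact hm (hfin.mem_toFinset.2 ⟨hp, not_le.1 h⟩)
        exact adele_norm_sub p hx ((hq p).2 hm)
    have := adele_norm_sub p h1 (Padic.norm_int_le_one (p := p) ⌊xr - q⌋)
    push_cast
    rwa [sub_sub] at this
  · push_cast
    rw [abs_le]
    have h1 := Int.floor_le (xr - q)
    have h2 := Int.lt_floor_add_one (xr - q)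
    constructor <;> linarith
end
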